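/- Let X be a complex Banach space, U ⊆ ℂ open, S ⊂ U a finite set, and let R : U ∖ S → B(X) be analytic and satisfy the resolvent identity R(λ) − R(μ) = (λ − μ) R(λ) R(μ) for all λ, μ ∈ U ∖ S. Let c ∈ ℂ and r > 0 be such that the closed disc of center c and radius r lies in U and S is contained in the open disc, let Γ be the positively oriented boundary circle, and set P = −(1/2πi)∮_Γ R(μ) dμ. Then for every f ∈ X and every λ in the open disc with λ ∉ S one has R(λ)(f − Pf) = (1/2πi)∮_Γ (μ − λ)⁻¹ R(μ)f dμ; consequently λ ↦ R(λ)(I − P) extends to an analytic B(X)-valued function on the whole open disc. -/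

import Mathlib

open Metric ContinuousLinearMap

theorem ContinuousLinearMap.circleIntegral_comp_comm
    {E F : Type*} [NormedAddCommGroup E] [NormedSpace ℂ E] [CompleteSpace E]
    [NormedAddCommGroup F] [NormedSpace ℂ F] [CompleteSpace F]
    (L : E →L[ℂ] F) {φ : ℂ → E} {c : ℂ} {r : ℝ} (hφ : CircleIntegrable φ c r) :
    (∮ z in C(c, r), L (φ z)) = L (∮ z in C(c, r), φ z) := by
  simp only [circleIntegral, ← map_smul]
  exact L.intervalIntegral_comp_comm hφ.out

/-- Let `X` be a complex Banach space, `U ⊆ ℂ` open, `S ⊂ U` finite, and let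
`R : U ∖ S → B(X)` be analytic and satisfy the resolvent identity
`R(λ) − R(μ) = (λ − μ) R(λ) R(μ)`.  If the closed disc of center `c` and radius `r > 0`
lies in `U`, `S` lies in the open disc, `Γ` is the positively oriented boundary circle and
`P = −(1/2πi) ∮_Γ R(μ) dμ`, then for every `f ∈ X` and every `λ` in the open disc with
`λ ∉ S` one has `R(λ)(f − Pf) = (1/2πi) ∮_Γ (μ − λ)⁻¹ R(μ) f dμ`; consequently
`λ ↦ R(λ)(I − P)` extends to an analytic `B(X)`-valued function on the whole open disc. -/
theorem resolvent_riesz_projection_formula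
    {X : Type*} [NormedAddCommGroup X] [NormedSpace ℂ X] [CompleteSpace X]
    (U : Set ℂ) (hU : IsOpen U) (S : Set ℂ) (hS : S.Finite) (hSU : S ⊆ U)
    (R : ℂ → X →L[ℂ] X)
    (hR_analytic : ∀ z ∈ U \ S, AnalyticAt ℂ R z)
    (hR_resolvent : ∀ lam ∈ U \ S, ∀ mu ∈ U \ S,
      R lam - R mu = (lam - mu) • (R lam ∘L R mu))
    (c : ℂ) (r : ℝ) (hr : 0 < r)
    (h_ball : closedBall c r ⊆ U) (hS_ball : S ⊆ ball c r)
    (P : X →L[ℂ] X)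
    (hP : P = (-(2 * (Real.pi : ℂ) * Complex.I)⁻¹) • (∮ mu in C(c, r), R mu)) :
    (∀ (f : X) (lam : ℂ), lam ∈ ball c r → lam ∉ S →
      R lam (f - P f) =
        (2 * (Real.pi : ℂ) * Complex.I)⁻¹ • (∮ mu in C(c, r), (mu - lam)⁻¹ • R mu f)) ∧
    (∃ F : ℂ → X →L[ℂ] X,
      (∀ z ∈ ball c r, AnalyticAt ℂ F z) ∧
      (∀ z ∈ ball c r, z ∉ S → F z = R z ∘L (1 - P))) := by
  have h_sphere : ∀ z ∈ sphere c r, z ∈ U \ S := fun z hz ↦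
    ⟨h_ball (sphere_subset_closedBall hz), fun hzS ↦
      (mem_ball.1 (hS_ball hzS)).ne (mem_sphere.1 hz)⟩
  have hR_cont : ContinuousOn R (sphere c r) := fun z hz ↦
    (hR_analytic z (h_sphere z hz)).continuousAt.continuousWithinAt
  have hR_int : CircleIntegrable R c r := hR_cont.circleIntegrable hr.le
  have h_ne : ∀ lam ∈ ball c r, ∀ mu ∈ sphere c r, mu - lam ≠ 0 := by
    intro lam hlam mu hmu h
    rw [sub_eq_zero.1 h] at hmu
    exact (mem_ball.1 hlam).ne (mem_sphere.1 hmu)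
  have h_kernel_cont : ∀ lam ∈ ball c r,
      ContinuousOn (fun mu ↦ (mu - lam)⁻¹) (sphere c r) := fun lam hlam ↦
    (continuousOn_id.sub continuousOn_const).inv₀ (h_ne lam hlam)
  have h_cauchy_int : ∀ lam ∈ ball c r,
      CircleIntegrable (fun mu ↦ (mu - lam)⁻¹ • R mu) c r := fun lam hlam ↦
    ((h_kernel_cont lam hlam).smul hR_cont).circleIntegrable hr.le
  have h_formula : ∀ lam ∈ ball c r, lam ∉ S → R lam ∘L (1 - P) =
      (2 * (Real.pi : ℂ) * Complex.I)⁻¹ • ∮ mu in C(c, r), (mu - lam)⁻¹ • R mu := by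
    intro lam hlam hlamS
    have h_const_int : CircleIntegrable (fun mu ↦ (mu - lam)⁻¹ • R lam) c r :=
      ((h_kernel_cont lam hlam).smul continuousOn_const).circleIntegrable hr.le
    have h_comp : R lam ∘L (∮ mu in C(c, r), R mu) =
        ∮ mu in C(c, r), R lam ∘L R mu :=
      ((compL ℂ X X X (R lam)).circleIntegral_comp_comm hR_int).symm
    have h_resolvent : (∮ mu in C(c, r), R lam ∘L R mu) =
        ∮ mu in C(c, r), ((mu - lam)⁻¹ • R mu - (mu - lam)⁻¹ • R lam) := by
      refine circleIntegral.integral_congr hr.le fun mu hmu ↦ ?_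
      rw [← smul_sub, ← neg_sub (R lam), hR_resolvent lam
        ⟨h_ball (ball_subset_closedBall hlam), hlamS⟩ mu (h_sphere mu hmu), ← neg_smul,
        neg_sub, inv_smul_smul₀ (h_ne lam hlam mu hmu)]
    have h_const : (∮ mu in C(c, r), (mu - lam)⁻¹ • R lam) =
        (2 * (Real.pi : ℂ) * Complex.I) • R lam := by
      rw [circleIntegral.integral_smul_const, circleIntegral.integral_sub_inv_of_mem_ball hlam]
    rw [comp_sub, hP, comp_smul, h_comp, h_resolvent,
      circleIntegral.integral_sub (h_cauchy_int lam hlam) h_const_int, h_const, neg_smul,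
      sub_neg_eq_add, smul_sub, inv_smul_smul₀ Complex.two_pi_I_ne_zero]
    change R lam + _ = _
    abel
  refine ⟨fun f lam hlam hlamS ↦ ?_,
    fun lam ↦ (2 * (Real.pi : ℂ) * Complex.I)⁻¹ • ∮ mu in C(c, r), (mu - lam)⁻¹ • R mu,
    fun z hz ↦ ?_, fun z hz hzS ↦ (h_formula z hz hzS).symm⟩
  · calc R lam (f - P f) = (R lam ∘L (1 - P)) f := rfl
      _ = _ := by
        rw [h_formula lam hlam hlamS, smul_apply]
        congr 1
        exact ((apply ℂ X f).circleIntegral_comp_comm (h_cauchy_int lam hlam)).symm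
  · lift r to NNReal using hr.le
    refine (hasFPowerSeriesOn_cauchy_integral hR_int (by exact_mod_cast hr)).analyticAt_of_mem ?_
    rwa [Metric.eball_coe]
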